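/- Let d ≥ 2 be an integer. For Lebesgue-almost every x ∈ [0,1), the inequality a_n(x) a_{2n}(x) ⋯ a_{dn}(x) ≥ n (log n)^2 holds for infinitely many positive integers n. -/

import Mathlib

open MeasureTheory Filter Set

/-- The Gauss map `T(x) = 1/x - ⌊1/x⌋` (with `T(0) = 0`). -/
noncomputable def gaussMap (x : ℝ) : ℝ := if x = 0 then 0 else 1 / x - (⌊1 / x⌋ : ℝ)

/-- The `n`-th partial quotient `a_n(x) = ⌊1 / T^{n-1}(x)⌋` (for `n ≥ 1`). -/
noncomputable def pq (n : ℕ) (x : ℝ) : ℕ := ⌊1 / (gaussMap^[n - 1] x)⌋₊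

/-- `Λ_d(Φ)`: irrational `x ∈ [0,1)` with `a_n(x) a_{2n}(x) ⋯ a_{dn}(x) ≥ Φ(n)`
for infinitely many `n`. -/
def Lambda (d : ℕ) (Φ : ℕ → ℝ) : Set ℝ :=
  {x | x ∈ Set.Ico (0 : ℝ) 1 ∧ Irrational x ∧
    ∃ᶠ n in Filter.atTop, Φ n ≤ ∏ i ∈ Finset.Icc 1 d, (pq (i * n) x : ℝ)}

def gI : Set ℝ := {x | x ∈ Ioo (0:ℝ) 1 ∧ Irrational x}

lemma gI_meas : MeasurableSet gI := by
  have h : MeasurableSet {x : ℝ | Irrational x} := by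
    have : {x : ℝ | Irrational x} = (Set.range ((↑) : ℚ → ℝ))ᶜ := by
      ext x; simp [Irrational]
    rw [this]
    exact (Set.countable_range _).measurableSet.compl
  exact measurableSet_Ioo.inter h

noncomputable def gm : Measure ℝ := volume.restrict gI

lemma gI_ae : gI =ᵐ[volume] Ioo (0:ℝ) 1 := by
  have h : ∀ᵐ x : ℝ, Irrational x := by
    have : (Set.range ((↑) : ℚ → ℝ)).Countable := Set.countable_range _
    have h2 := this.ae_notMem (volume : Measure ℝ)
    filter_upwards [h2] with x hx
    exact hx
  filter_upwards [h] with x hx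
  simp only [eq_iff_iff]
  exact ⟨fun h => h.1, fun h => ⟨h, hx⟩⟩

lemma gm_eq : gm = volume.restrict (Ioo (0:ℝ) 1) := Measure.restrict_congr_set gI_ae

instance gm_prob : IsProbabilityMeasure gm := by
  constructor
  rw [gm_eq]; simp

lemma gm_ae : ∀ᵐ x ∂gm, x ∈ gI := ae_restrict_mem gI_meas

lemma gaussMap_meas : Measurable gaussMap := by
  unfold gaussMap
  apply Measurable.ite (measurableSet_singleton 0) measurable_const
  have h : Measurable (fun x : ℝ => 1 / x) := by fun_prop
  have h2 : Measurable (fun x : ℝ => ((⌊1 / x⌋ : ℤ) : ℝ)) :=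
    (measurable_from_top (f := fun z : ℤ => (z:ℝ))).comp (Int.measurable_floor.comp h)
  exact h.sub h2

lemma gaussIt_meas (n : ℕ) : Measurable (gaussMap^[n]) := gaussMap_meas.iterate n

lemma pq_meas (n : ℕ) : Measurable (pq n) := by
  unfold pq
  have := gaussIt_meas (n-1)
  exact Nat.measurable_floor.comp (by fun_prop)

lemma gaussMap_mem {x : ℝ} (hx : x ∈ gI) : gaussMap x ∈ gI := by
  obtain ⟨⟨h0, h1⟩, hi⟩ := hx
  have hirr : Irrational (1 / x - (⌊1 / x⌋ : ℝ)) := by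
    have : Irrational (1/x) := by rw [one_div]; exact hi.inv
    exact this.sub_intCast _
  unfold gaussMap
  rw [if_neg h0.ne']
  refine ⟨⟨?_, ?_⟩, hirr⟩
  · exact lt_of_le_of_ne (Int.fract_nonneg (1/x)) (hirr.ne_zero).symm
  · exact Int.fract_lt_one (1/x)

lemma gaussIt_mem {x : ℝ} (hx : x ∈ gI) (n : ℕ) : gaussMap^[n] x ∈ gI := by
  induction n with
  | zero => exact hx
  | succ n ih => rw [Function.iterate_succ_apply']; exact gaussMap_mem ih

lemma floor_pos_gI {t : ℝ} (ht : t ∈ gI) : 1 ≤ ⌊1/t⌋₊ := by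
  apply Nat.le_floor
  push_cast
  rw [le_div_iff₀ ht.1.1]; linarith [ht.1.2]

lemma gauss_eq {t : ℝ} (ht : t ∈ gI) : gaussMap t = 1/t - (⌊1/t⌋₊ : ℝ) := by
  unfold gaussMap
  rw [if_neg ht.1.1.ne', natCast_floor_eq_intCast_floor (by have := ht.1.1; positivity)]

lemma step_lt {t : ℝ} (ht : t ∈ gI) (a : ℕ) (ha : 1 ≤ a) (u : ℝ) (hu0 : 0 ≤ u) (hu : u ≤ 1) :
    (⌊1/t⌋₊ = a ∧ gaussMap t < u) ↔ (t ≤ 1/(a:ℝ) ∧ ¬ (t ≤ 1/((a:ℝ)+u))) := by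
  have h0 := ht.1.1
  have ha' : (1:ℝ) ≤ a := by exact_mod_cast ha
  rw [gauss_eq ht, not_le, le_div_iff₀ (by linarith), div_lt_iff₀ (by linarith), mul_comm t, mul_comm t,
    ← le_div_iff₀ h0, ← div_lt_iff₀ h0]
  constructor
  · rintro ⟨rfl, h⟩
    exact ⟨Nat.floor_le (by positivity), by linarith⟩
  · rintro ⟨h1, h2⟩
    have : ⌊1/t⌋₊ = a := by
      rw [Nat.floor_eq_iff (by positivity)]
      exact ⟨h1, by linarith⟩
    rw [this]
    exact ⟨rfl, by linarith⟩

lemma step_le {t : ℝ} (ht : t ∈ gI) (a : ℕ) (ha : 1 ≤ a) (u : ℝ) (hu0 : 0 ≤ u) (hu : u < 1) :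
    (⌊1/t⌋₊ = a ∧ gaussMap t ≤ u) ↔ (t ≤ 1/(a:ℝ) ∧ ¬ (t < 1/((a:ℝ)+u))) := by
  have h0 := ht.1.1
  have ha' : (1:ℝ) ≤ a := by exact_mod_cast ha
  rw [gauss_eq ht, not_lt, le_div_iff₀ (by linarith), div_le_iff₀ (by linarith), mul_comm t, mul_comm t,
    ← le_div_iff₀ h0, ← div_le_iff₀ h0]
  constructor
  · rintro ⟨rfl, h⟩
    exact ⟨Nat.floor_le (by positivity), by linarith⟩
  · rintro ⟨h1, h2⟩
    have : ⌊1/t⌋₊ = a := by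
      rw [Nat.floor_eq_iff (by positivity)]
      exact ⟨h1, by linarith⟩
    rw [this]
    exact ⟨rfl, by linarith⟩

def cyl (n : ℕ) (w : ℕ → ℕ) : Set ℝ := {x | x ∈ gI ∧ ∀ i < n, pq (i+1) x = w i}

lemma cyl_meas (n : ℕ) (w : ℕ → ℕ) : MeasurableSet (cyl n w) := by
  have : cyl n w = gI ∩ ⋂ i, ⋂ (_ : i < n), pq (i+1) ⁻¹' {w i} := by
    ext x; simp [cyl]
  rw [this]
  exact gI_meas.inter (MeasurableSet.iInter fun i => MeasurableSet.iInter fun _ =>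
    pq_meas _ (measurableSet_singleton _))

lemma cyl_succ (n : ℕ) (w : ℕ → ℕ) {x : ℝ} :
    x ∈ cyl (n+1) w ↔ x ∈ cyl n w ∧ ⌊1/(gaussMap^[n] x)⌋₊ = w n := by
  simp only [cyl, mem_ofPred_eq, Nat.lt_succ_iff_lt_or_eq]
  constructor
  · rintro ⟨h, h2⟩
    exact ⟨⟨h, fun i hi => h2 i (Or.inl hi)⟩, h2 n (Or.inr rfl)⟩
  · rintro ⟨⟨h, h2⟩, h3⟩
    refine ⟨h, fun i hi => ?_⟩
    rcases hi with hi | rfl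
    · exact h2 i hi
    · exact h3

lemma key (n : ℕ) (w : ℕ → ℕ) : ∃ C s : ℝ, 0 ≤ C ∧ 0 ≤ s ∧ s ≤ 1 ∧ ∀ u : ℝ, 0 ≤ u → u ≤ 1 →
    gm.real (cyl n w ∩ {x | gaussMap^[n] x < u}) = C * u / (1 + s * u) ∧
    gm.real (cyl n w ∩ {x | gaussMap^[n] x ≤ u}) = C * u / (1 + s * u) := by
  induction n with
  | zero =>
    refine ⟨1, 0, by norm_num, by norm_num, by norm_num, fun u hu0 hu1 => ?_⟩
    have hc : cyl 0 w = gI := by ext x; simp [cyl]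
    rw [hc]
    simp only [Function.iterate_zero, id]
    have hI : ∀ S : Set ℝ, MeasurableSet S → gm.real (gI ∩ S) = volume.real (S ∩ Ioo 0 1) := by
      intro S hS
      have h1 : gm.real (gI ∩ S) = gm.real S := by
        apply measureReal_congr
        filter_upwards [gm_ae] with x hx
        simp only [eq_iff_iff]
        exact ⟨fun h => h.2, fun h => ⟨hx, h⟩⟩
      rw [h1, gm_eq, measureReal_restrict_apply hS]
    constructor
    · rw [hI {x | x < u} measurableSet_Iio]
      have : {x : ℝ | x < u} ∩ Ioo 0 1 = Ioo 0 u := by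
        ext x; simp only [mem_inter_iff, mem_ofPred_eq, mem_Ioo]
        constructor
        · rintro ⟨h, h2, h3⟩; exact ⟨h2, h⟩
        · rintro ⟨h, h2⟩; exact ⟨h2, h, by linarith⟩
      rw [this, Real.volume_real_Ioo_of_le hu0]; ring
    · rw [hI {x | x ≤ u} measurableSet_Iic]
      have : volume.real ({x : ℝ | x ≤ u} ∩ Ioo 0 1) = volume.real (Ioo 0 u) := by
        apply le_antisymm
        · have h1 : volume.real (Ioo 0 u) = volume.real (Ioc 0 u) := by
            rw [Real.volume_real_Ioo_of_le hu0, Real.volume_real_Ioc_of_le hu0]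
          rw [h1]
          refine measureReal_mono ?_ (by simp)
          rintro x ⟨h, h2, h3⟩; exact ⟨h2, h⟩
        · refine measureReal_mono ?_ (ne_top_of_le_ne_top (b := volume (Ioo (0:ℝ) 1)) (by simp) (measure_mono inter_subset_right))
          rintro x ⟨h, h2⟩; exact ⟨h2.le, h, by linarith⟩
      rw [this, Real.volume_real_Ioo_of_le hu0]; ring
  | succ n ih =>
    obtain ⟨C, s, hC, hs0, hs1, H⟩ := ih
    rcases Nat.eq_zero_or_pos (w n) with h0 | ha
    · refine ⟨0, 0, by norm_num, by norm_num, by norm_num, fun u hu0 hu1 => ?_⟩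
      have : cyl (n+1) w = ∅ := by
        ext x
        simp only [cyl_succ, mem_empty_iff_false, iff_false]
        rintro ⟨h, h2⟩
        have := floor_pos_gI (gaussIt_mem h.1 n)
        omega
      simp [this]
    have ha' : (1:ℝ) ≤ w n := by exact_mod_cast ha
    set a : ℝ := (w n : ℝ) with hadef
    have has : 0 < a + s := by linarith
    have hm1 : ∀ u : ℝ, MeasurableSet (cyl n w ∩ {x | gaussMap^[n] x < u}) := fun u =>
      (cyl_meas n w).inter (measurableSet_lt (gaussIt_meas n) measurable_const)
    have hm2 : ∀ u : ℝ, MeasurableSet (cyl n w ∩ {x | gaussMap^[n] x ≤ u}) := fun u =>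
      (cyl_meas n w).inter (measurableSet_le (gaussIt_meas n) measurable_const)
    have A : ∀ u : ℝ, 0 ≤ u → u ≤ 1 → 1 / (a+u) ≤ 1 / a ∧ 0 ≤ 1/(a+u) ∧ 1/a ≤ 1 := by
      intro u hu0 hu1
      refine ⟨one_div_le_one_div_of_le (by linarith) (by linarith), by positivity, ?_⟩
      rw [div_le_one (by linarith)]; exact ha'
    have B : ∀ u : ℝ, 0 ≤ u → u ≤ 1 → C * (1/a) / (1 + s * (1/a)) - C * (1/(a+u)) / (1 + s * (1/(a+u)))
        = C / (a+s)^2 * u / (1 + 1/(a+s) * u) := by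
      intro u hu0 hu1
      have h1 : 1 + s * (1/a) = (a+s)/a := by field_simp
      have h2 : 1 + s * (1/(a+u)) = (a+s+u)/(a+u) := by field_simp; ring
      have h3 : 1 + 1/(a+s)*u = (a+s+u)/(a+s) := by field_simp
      have h4 : a + s + u ≠ 0 := by positivity
      have h5 : a + u ≠ 0 := by positivity
      have h6 : a ≠ 0 := by positivity
      rw [h1, h2, h3]
      field_simp
      ring
    have Hlt : ∀ u : ℝ, 0 ≤ u → u ≤ 1 →
        gm.real (cyl (n+1) w ∩ {x | gaussMap^[n+1] x < u}) = C / (a+s)^2 * u / (1 + 1/(a+s) * u) := by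
      intro u hu0 hu1
      obtain ⟨A1, A2, A3⟩ := A u hu0 hu1
      have e : cyl (n+1) w ∩ {x | gaussMap^[n+1] x < u} =
          (cyl n w ∩ {x | gaussMap^[n] x ≤ 1/a}) \ (cyl n w ∩ {x | gaussMap^[n] x ≤ 1/(a+u)}) := by
        ext x
        have := fun h : x ∈ gI => step_lt (gaussIt_mem h n) (w n) ha u hu0 hu1
        simp only [mem_inter_iff, cyl_succ, mem_ofPred_eq, Set.mem_sdiff, Function.iterate_succ_apply']
        by_cases hx : x ∈ cyl n w
        · have := this hx.1
          simp only [hx, true_and]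
          exact this
        · simp [hx]
      rw [e, measureReal_sdiff, (H (1/a) (by linarith) A3).2,
        (H (1/(a+u)) A2 (by linarith)).2, B u hu0 hu1]
      · rintro x ⟨h1, h2⟩; exact ⟨h1, le_trans h2 A1⟩
      · exact hm2 _
    refine ⟨C / (a+s)^2, 1/(a+s), by positivity, by positivity, ?_, fun u hu0 hu1 => ⟨Hlt u hu0 hu1, ?_⟩⟩
    · rw [div_le_one has]; linarith
    rcases hu1.lt_or_eq with hu1 | rfl
    · obtain ⟨A1, A2, A3⟩ := A u hu0 hu1.le
      have e : cyl (n+1) w ∩ {x | gaussMap^[n+1] x ≤ u} =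
          (cyl n w ∩ {x | gaussMap^[n] x ≤ 1/a}) \ (cyl n w ∩ {x | gaussMap^[n] x < 1/(a+u)}) := by
        ext x
        have := fun h : x ∈ gI => step_le (gaussIt_mem h n) (w n) ha u hu0 hu1
        simp only [mem_inter_iff, cyl_succ, mem_ofPred_eq, Set.mem_sdiff, Function.iterate_succ_apply']
        by_cases hx : x ∈ cyl n w
        · have := this hx.1
          simp only [hx, true_and]
          exact this
        · simp [hx]
      rw [e, measureReal_sdiff, (H (1/a) (by linarith) A3).2,
        (H (1/(a+u)) A2 (by linarith)).1, B u hu0 hu1.le]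
      · rintro x ⟨h1, h2⟩; exact ⟨h1, le_trans (le_of_lt h2) A1⟩
      · exact hm1 _
    · rw [← Hlt 1 hu0 le_rfl]
      congr 1
      ext x
      simp only [mem_inter_iff, mem_ofPred_eq, and_congr_right_iff]
      intro hx
      have := (gaussIt_mem hx.1 (n+1)).1.2
      exact ⟨fun _ => this, le_of_lt⟩

lemma cyl_bound (n : ℕ) (w : ℕ → ℕ) (k : ℕ) (hk : 1 ≤ k) :
    (1/(k:ℝ)) * gm.real (cyl n w) ≤ gm.real (cyl n w ∩ {x | k ≤ pq (n+1) x}) := by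
  obtain ⟨C, s, hC, hs0, hs1, H⟩ := key n w
  have hk' : (1:ℝ) ≤ k := by exact_mod_cast hk
  have hk1 : 1/(k:ℝ) ≤ 1 := by rw [div_le_one (by linarith)]; exact hk'
  have h1 : gm.real (cyl n w) = C / (1+s) := by
    have := (H 1 zero_le_one le_rfl).1
    rw [mul_one, mul_one] at this
    rw [← this]
    congr 1
    ext x
    simp only [mem_inter_iff, mem_ofPred_eq, iff_self_and]
    intro hx
    exact (gaussIt_mem hx.1 n).1.2
  have h2 := (H (1/k) (by positivity) hk1).1
  calc (1/(k:ℝ)) * gm.real (cyl n w) = C * (1/k) / (1+s) := by rw [h1]; ring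
    _ ≤ C * (1/k) / (1 + s * (1/k)) := by
      apply div_le_div_of_nonneg_left (by positivity) (by positivity)
      nlinarith
    _ = _ := h2.symm
    _ ≤ _ := by
      refine measureReal_mono ?_
      rintro x ⟨hx, hx2⟩
      refine ⟨hx, ?_⟩
      simp only [mem_ofPred_eq, pq, Nat.add_sub_cancel] at hx2 ⊢
      have h0 := (gaussIt_mem hx.1 n).1.1
      apply Nat.le_floor
      rw [le_div_iff₀ h0]
      rw [lt_div_iff₀ (by linarith)] at hx2
      linarith

noncomputable def digits (n : ℕ) (x : ℝ) : Fin n → ℕ := fun i => pq (i+1) x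

lemma digits_meas (n : ℕ) : Measurable (digits n) := by
  rw [measurable_pi_iff]
  exact fun i => pq_meas _

noncomputable def gF : Filtration ℕ (inferInstance : MeasurableSpace ℝ) where
  seq n := MeasurableSpace.comap (digits n) inferInstance
  mono' := by
    intro m n hmn
    have : digits m = (fun v : Fin n → ℕ => fun i : Fin m => v ⟨i, by omega⟩) ∘ digits n := by
      ext x i; rfl
    show MeasurableSpace.comap (digits m) inferInstance ≤ MeasurableSpace.comap (digits n) inferInstance
    rw [this, ← MeasurableSpace.comap_comp]
    exact MeasurableSpace.comap_mono (Measurable.comap_le (by fun_prop))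
  le' n := (digits_meas n).comap_le

lemma pq_gF {m n : ℕ} (h1 : 1 ≤ m) (h : m ≤ n) : Measurable[gF n] (pq m) := by
  have : pq m = (fun v : Fin n → ℕ => v ⟨m-1, by omega⟩) ∘ digits n := by
    ext x; simp only [digits, Function.comp]; congr 1; omega
  rw [this]
  have h2 : Measurable[gF n] (digits n) := comap_measurable (digits n)
  exact Measurable.comp (by fun_prop) h2

lemma fib_bound (n k : ℕ) (hk : 1 ≤ k) (B : Set ℝ) (hB : B = {x | k ≤ pq (n+1) x}) (s : Fin n → ℕ) :
    (1/(k:ℝ)) * gm.real (digits n ⁻¹' {s}) ≤ gm.real (digits n ⁻¹' {s} ∩ B) := by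
    let w : ℕ → ℕ := fun i => if h : i < n then s ⟨i, h⟩ else 0
    have e : (digits n ⁻¹' {s} : Set ℝ) =ᵐ[gm] cyl n w := by
      filter_upwards [gm_ae] with x hx
      apply propext
      change digits n x ∈ ({s} : Set _) ↔ (x ∈ gI ∧ ∀ i < n, pq (i+1) x = w i)
      simp only [mem_singleton_iff, hx, true_and, funext_iff, digits]
      constructor
      · intro h i hi
        simp only [w, hi, dif_pos]
        exact h ⟨i, hi⟩
      · intro h i
        have := h i i.2
        simpa [w] using this
    have e2 : (digits n ⁻¹' {s} ∩ B : Set ℝ) =ᵐ[gm] (cyl n w ∩ B : Set ℝ) := e.inter (ae_eq_refl _)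
    rw [measureReal_congr e, measureReal_congr e2]
    rw [hB]; exact cyl_bound n w k hk

lemma fib_sum (n : ℕ) (S : Set (Fin n → ℕ)) (D : Set ℝ) (hD : MeasurableSet D) :
      HasSum (fun s : S => gm.real (digits n ⁻¹' {s.1} ∩ D)) (gm.real (digits n ⁻¹' S ∩ D)) := by
    have hU : digits n ⁻¹' S ∩ D = ⋃ s : S, (digits n ⁻¹' {s.1} ∩ D) := by
      ext x; simp
    have hm : gm (⋃ s : S, (digits n ⁻¹' {s.1} ∩ D)) = ∑' s : S, gm (digits n ⁻¹' {s.1} ∩ D) := by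
      refine measure_iUnion ?_ ?_
      rotate_left
      · intro i
        exact (digits_meas n (measurableSet_singleton _)).inter hD
      · intro i j hij
        refine Set.disjoint_left.mpr ?_
        rintro x ⟨h1, -⟩ ⟨h2, -⟩
        exact hij (Subtype.ext (h1.symm.trans h2))
    rw [hU, measureReal_def, hm]
    have hne : ∑' s : S, gm (digits n ⁻¹' {s.1} ∩ D) ≠ ⊤ := by rw [← hm]; exact measure_ne_top _ _
    have hr := ENNReal.summable_toReal hne
    rw [ENNReal.tsum_toReal_eq (fun s => measure_ne_top _ _)]
    exact hr.hasSum

lemma set_bound (n k : ℕ) (hk : 1 ≤ k) (A : Set ℝ) (hA : MeasurableSet[gF n] A) :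
    (1/(k:ℝ)) * gm.real A ≤ gm.real (A ∩ {x | k ≤ pq (n+1) x}) := by
  have hBm : MeasurableSet {x | k ≤ pq (n+1) x} := measurableSet_le measurable_const (pq_meas _)
  have hA' : ∃ S : Set (Fin n → ℕ), digits n ⁻¹' S = A := by
    have hA2 : MeasurableSet[MeasurableSpace.comap (digits n) inferInstance] A := hA
    obtain ⟨S, -, h⟩ := MeasurableSpace.measurableSet_comap.1 hA2
    exact ⟨S, h⟩
  obtain ⟨S, hS⟩ := hA'
  have h1 := fib_sum n S univ MeasurableSet.univ
  have h2 := fib_sum n S _ hBm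
  simp only [inter_univ] at h1
  rw [← hS]
  have h3 : HasSum (fun s : S => (1/(k:ℝ)) * gm.real (digits n ⁻¹' {s.1})) ((1/(k:ℝ)) * gm.real (digits n ⁻¹' S)) :=
    h1.mul_left _
  refine hasSum_le (fun s => ?_) h3 h2
  exact fib_bound n k hk _ rfl s.1

lemma cond_bound (n k : ℕ) (hk : 1 ≤ k) :
    ∀ᵐ x ∂gm, 1/(k:ℝ) ≤ (gm[({x | k ≤ pq (n+1) x} : Set ℝ).indicator (1 : ℝ → ℝ) | gF n]) x := by
  set B : Set ℝ := {x | k ≤ pq (n+1) x} with hB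
  have hBm : MeasurableSet B := measurableSet_le measurable_const (pq_meas _)
  have hint : Integrable (B.indicator (1 : ℝ → ℝ)) gm := (integrable_const (1:ℝ)).indicator hBm
  have h := ae_le_of_forall_setIntegral_le (μ := gm.trim (gF.le n)) (f := fun _ => 1/(k:ℝ))
    (g := gm[B.indicator (1 : ℝ → ℝ) | gF n]) (integrable_const _)
    (integrable_condExp.trim _ stronglyMeasurable_condExp) ?_
  · exact ae_le_of_ae_le_trim h
  · intro A hA _
    rw [← setIntegral_trim (gF.le n) stronglyMeasurable_condExp hA,
      setIntegral_condExp (gF.le n) hint hA, setIntegral_const, integral_indicator_one hBm, measureReal_restrict_apply hBm,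
      smul_eq_mul, mul_comm, inter_comm]
    have := set_bound n k hk A hA
    rw [measureReal_def, trim_measurableSet_eq (gF.le n) hA]
    exact this

noncomputable def gL (n : ℕ) : ℝ := (n:ℝ) * (Real.log n)^2

lemma gL_nonneg (n : ℕ) : 0 ≤ gL n := by unfold gL; positivity

noncomputable def gX (n : ℕ) (x : ℝ) : ℝ := min 1 ((pq n x : ℝ) / gL n)

lemma gX_nonneg (n : ℕ) (x : ℝ) : 0 ≤ gX n x := by
  have := gL_nonneg n
  unfold gX; positivity

lemma gX_le (n : ℕ) (x : ℝ) : gX n x ≤ 1 := min_le_left _ _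

lemma gX_meas {m n : ℕ} (h1 : 1 ≤ m) (h : m ≤ n) : Measurable[gF n] (gX m) := by
  have h2 : Measurable[gF n] (fun x => (pq m x : ℝ)) :=
    (measurable_from_top (f := fun z : ℕ => (z:ℝ))).comp (pq_gF h1 h)
  exact Measurable.min measurable_const (h2.div_const _)

lemma gX_int (n : ℕ) (h : 1 ≤ n): Integrable (gX n) gm := by
  refine Integrable.of_bound (C := 1) ((gX_meas h le_rfl).mono (gF.le n) le_rfl).aestronglyMeasurable ?_
  filter_upwards with x
  rw [Real.norm_of_nonneg (gX_nonneg _ _)]; exact gX_le _ _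

lemma not_summable_inv_log : ¬ Summable (fun n : ℕ => 1 / (((n:ℝ)+3) * Real.log ((n:ℝ)+3))) := by
  intro h
  have hh : Summable (fun n : ℕ => 1 / (((n:ℝ)+2) * Real.log ((n:ℝ)+2))) := by
    rw [← summable_nat_add_iff 1]
    have e : (fun n : ℕ => 1 / ((((n+1:ℕ):ℝ)+2) * Real.log (((n+1:ℕ):ℝ)+2))) =
        fun n : ℕ => 1 / (((n:ℝ)+3) * Real.log ((n:ℝ)+3)) := by
      funext n
      have : ((n+1:ℕ):ℝ)+2 = n+3 := by push_cast; ring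
      rw [this]
    rw [e]; exact h
  rw [← summable_condensed_iff_of_nonneg] at hh
  · have : Summable (fun n : ℕ => (1 / (n+2 : ℝ)) * (1/2)) := by
      rw [← summable_nat_add_iff 1] at hh
      refine Summable.of_nonneg_of_le (fun n => by positivity) (fun n => ?_) hh
      have h2 : (2:ℝ) ≤ (2:ℝ)^(n+1) := by
        rw [pow_succ]; have : (1:ℝ) ≤ 2^n := one_le_pow₀ (by norm_num)
        linarith
      have hlog : Real.log ((2:ℝ)^(n+1) + 2) ≤ n+2 := by
        calc Real.log ((2:ℝ)^(n+1) + 2) ≤ Real.log ((2:ℝ)^(n+2)) := by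
              apply Real.log_le_log (by positivity)
              rw [pow_succ _ (n+1)]; linarith
          _ = (n+2) * Real.log 2 := by rw [Real.log_pow]; push_cast; ring
          _ ≤ (n+2) * 1 := by
              have := Real.log_two_lt_d9
              gcongr; linarith
          _ = n + 2 := by ring
      have hlog0 : 0 < Real.log ((2:ℝ)^(n+1) + 2) := Real.log_pos (by linarith)
      push_cast
      rw [one_div_mul_one_div, mul_one_div, div_le_div_iff₀ (by positivity) (by positivity)]
      nlinarith [mul_le_mul (show (2:ℝ)^(n+1)+2 ≤ 2*2^(n+1) by linarith) hlog hlog0.le (by positivity)]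
    have h3 := (summable_mul_right_iff (by norm_num : (1/2:ℝ) ≠ 0)).1 this
    have : Summable (fun n : ℕ => 1 / (n : ℝ)) := by
      rw [← summable_nat_add_iff 2]
      simpa using h3
    exact Real.not_summable_one_div_natCast this
  · intro n
    have : 0 ≤ Real.log ((n:ℝ)+2) := Real.log_nonneg (by linarith [(Nat.cast_nonneg n : (0:ℝ) ≤ n)])
    positivity
  · intro m n _ hmn
    have h1 : (m:ℝ) ≤ n := by exact_mod_cast hmn
    have h0 : (0:ℝ) ≤ m := by positivity
    have : 0 < Real.log ((m:ℝ)+2) := Real.log_pos (by linarith)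
    have h3 : Real.log ((m:ℝ)+2) ≤ Real.log ((n:ℝ)+2) := Real.log_le_log (by linarith) (by linarith)
    gcongr

lemma gX_cond (n : ℕ) (hn : 2 ≤ n) :
    ∀ᵐ x ∂gm, 1 / (((n:ℝ)+1) * Real.log ((n:ℝ)+1)) ≤ (gm[gX (n+1) | gF n]) x := by
  set Lr := gL (n+1) with hL
  have hn' : (2:ℝ) ≤ n := by exact_mod_cast hn
  have hlog : 1 ≤ Real.log ((n:ℝ)+1) := by
    rw [Real.le_log_iff_exp_le (by linarith)]
    linarith [Real.exp_one_lt_d9]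
  have hLe : Lr = ((n:ℝ)+1) * (Real.log ((n:ℝ)+1))^2 := by rw [hL, gL]; push_cast; rfl
  have hLn : (n:ℝ)+1 ≤ Lr := by rw [hLe]; have := one_le_pow₀ (n := 2) hlog; nlinarith
  have hL0 : 0 < Lr := by linarith
  set K := ⌊Lr⌋₊ with hK
  let g : ℕ → ℝ → ℝ := fun k => ({x | k+1 ≤ pq (n+1) x} : Set ℝ).indicator (1 : ℝ → ℝ)
  have hgi : ∀ k, Integrable (g k) gm := fun k =>
    (integrable_const (1:ℝ)).indicator (measurableSet_le measurable_const (pq_meas _))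
  have hle : (1/Lr) • (∑ k ∈ Finset.range K, g k) ≤ᵐ[gm] gX (n+1) := by
    filter_upwards with x
    have hsum : (∑ k ∈ Finset.range K, g k) x = min (K:ℝ) (pq (n+1) x) := by
      rw [Finset.sum_apply]
      have : ∀ k, g k x = if k < pq (n+1) x then (1:ℝ) else 0 := by
        intro k
        simp [g, Set.indicator_apply, Nat.succ_le_iff]
      simp only [this]
      rw [Finset.sum_ite]
      simp only [Finset.sum_const, smul_eq_mul, nsmul_eq_mul, mul_one, mul_zero, add_zero]
      have : (Finset.range K).filter (fun k => k < pq (n+1) x) = Finset.range (min K (pq (n+1) x)) := by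
        ext k; simp
      rw [this, Finset.card_range]; push_cast; rfl
    rw [Pi.smul_apply, hsum, smul_eq_mul, gX]
    refine le_min ?_ ?_
    · rw [one_div_mul_eq_div, div_le_one hL0]
      exact (min_le_left _ _).trans (Nat.floor_le hL0.le)
    · rw [one_div_mul_eq_div]
      gcongr
      exact min_le_right _ _
  have hsi : Integrable (∑ k ∈ Finset.range K, g k) gm := integrable_finsetSum' _ fun k _ => hgi k
  have h1 := condExp_mono (m := gF n) (hsi.smul (1/Lr)) (gX_int (n+1) (by omega)) hle
  have h2 := condExp_smul (μ := gm) (1/Lr) (∑ k ∈ Finset.range K, g k) (gF n)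
  have h3 := condExp_finsetSum (μ := gm) (s := Finset.range K) (f := g) (fun k _ => hgi k) (gF n)
  have h4 : ∀ᵐ x ∂gm, ∀ k : ℕ, 1/((k+1:ℕ):ℝ) ≤ (gm[g k | gF n]) x := by
    rw [ae_all_iff]; exact fun k => cond_bound n (k+1) (by omega)
  filter_upwards [h1, h2, h3, h4] with x h1 h2 h3 h4
  refine le_trans ?_ h1
  rw [h2, Pi.smul_apply, h3, Finset.sum_apply, smul_eq_mul]
  have h5 : Real.log ((n:ℝ)+1) ≤ ∑ k ∈ Finset.range K, (gm[g k | gF n]) x := by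
    calc Real.log ((n:ℝ)+1) ≤ Real.log ((K+1 : ℕ):ℝ) := by
          apply Real.log_le_log (by linarith)
          push_cast
          linarith [Nat.lt_floor_add_one Lr]
      _ ≤ harmonic K := log_add_one_le_harmonic K
      _ = ∑ k ∈ Finset.range K, 1/((k+1:ℕ):ℝ) := by
          rw [harmonic]; push_cast; simp
      _ ≤ _ := Finset.sum_le_sum fun k _ => h4 k
  calc 1 / (((n:ℝ)+1) * Real.log ((n:ℝ)+1)) = 1/Lr * Real.log ((n:ℝ)+1) := by
        rw [hLe]; have : Real.log ((n:ℝ)+1) ≠ 0 := by linarith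
        field_simp
    _ ≤ _ := by gcongr

lemma tendsto_sum_of_le {f g : ℕ → ℝ} (hf : ∀ n, 0 ≤ f n) (hg : ∀ n, 0 ≤ g n)
    (hns : ¬ Summable f) (N : ℕ) (c : ℝ) (hc : 0 < c) (h : ∀ n, N ≤ n → c * f n ≤ g n) :
    Tendsto (fun n => ∑ k ∈ Finset.range n, g k) atTop atTop := by
  rw [← not_summable_iff_tendsto_nat_atTop_of_nonneg hg]
  intro hs
  apply hns
  rw [← summable_nat_add_iff N] at hs ⊢
  have := Summable.of_nonneg_of_le (fun n => mul_nonneg hc.le (hf _)) (fun n => h (n+N) (by omega)) hs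
  exact (summable_mul_left_iff hc.ne').1 this

lemma gX_div : ∀ᵐ x ∂gm, ¬ Summable (fun n => gX (n+1) x) := by
  let f : ℕ → ℝ → ℝ := fun n x => ∑ k ∈ Finset.range n, gX (k+1) x
  have hd : ∀ n, f (n+1) - f n = gX (n+1) := by
    intro n; ext x; simp [f, Finset.sum_range_succ]
  have hd' : ∀ n x, f (n+1) x - f n x = gX (n+1) x := fun n x => congrFun (hd n) x
  have key := tendsto_sum_indicator_atTop_iff (μ := gm) (ℱ := gF) (f := f) (R := 1)
    (Eventually.of_forall fun x n => by have := hd' n x; have := gX_nonneg (n+1) x; linarith)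
    (fun n => by
      apply Measurable.stronglyMeasurable
      refine Finset.measurable_fun_sum _ fun k hk => gX_meas (by omega) ?_
      have := Finset.mem_range.1 hk; omega)
    (fun n => integrable_finsetSum _ fun k _ => gX_int _ (by omega))
    (Eventually.of_forall fun x n => by
      rw [hd', abs_of_nonneg (gX_nonneg _ _)]; exact gX_le _ _)
  have hb : ∀ᵐ x ∂gm, ∀ n : ℕ, 2 ≤ n → 1 / (((n:ℝ)+1) * Real.log ((n:ℝ)+1)) ≤ (gm[gX (n+1) | gF n]) x := by
    rw [ae_all_iff]; intro n
    by_cases hn : 2 ≤ n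
    · filter_upwards [gX_cond n hn] with x hx _ using hx
    · exact Eventually.of_forall fun x h => absurd h hn
  have hb0 : ∀ᵐ x ∂gm, ∀ n : ℕ, 0 ≤ (gm[gX (n+1) | gF n]) x := by
    rw [ae_all_iff]; intro n
    exact condExp_nonneg (Eventually.of_forall fun x => gX_nonneg _ _)
  filter_upwards [key, hb, hb0] with x hx hb hb0
  have hT : Tendsto (fun n => predictablePart f gF gm n x) atTop atTop := by
    have e : (fun n => predictablePart f gF gm n x) =
        fun n => ∑ k ∈ Finset.range n, (gm[gX (k+1) | gF k]) x := by
      ext n; simp only [predictablePart, Finset.sum_apply, hd]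
    rw [e]
    refine tendsto_sum_of_le (f := fun n : ℕ => 1 / (((n:ℝ)+1) * Real.log ((n:ℝ)+1))) ?_ hb0 ?_ 2 1 one_pos ?_
    · intro n
      have : 0 ≤ Real.log ((n:ℝ)+1) := Real.log_nonneg (by linarith [(Nat.cast_nonneg n : (0:ℝ) ≤ n)])
      positivity
    · rw [← summable_nat_add_iff 2]
      have e : (fun n : ℕ => 1 / ((((n+2:ℕ):ℝ)+1) * Real.log (((n+2:ℕ):ℝ)+1))) =
          fun n : ℕ => 1 / (((n:ℝ)+3) * Real.log ((n:ℝ)+3)) := by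
        funext n
        have : ((n+2:ℕ):ℝ)+1 = n+3 := by push_cast; ring
        rw [this]
      rw [e]; exact not_summable_inv_log
    · intro n hn; rw [one_mul]; exact hb n hn
  have := hx.2 hT
  rwa [not_summable_iff_tendsto_nat_atTop_of_nonneg (fun n => gX_nonneg _ _)]

noncomputable def gG : Filtration ℕ (inferInstance : MeasurableSpace ℝ) where
  seq n := gF (2*n+1)
  mono' := fun m n h => gF.mono (by omega)
  le' n := gF.le _

noncomputable def gS (n : ℕ) : Set ℝ := if n = 0 then ∅ else {x | gL n ≤ (pq n x : ℝ) * (pq (2*n) x : ℝ)}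

lemma gS_meas (n m : ℕ) (h : 2 * n ≤ m) : MeasurableSet[gF m] (gS n) := by
  unfold gS
  split_ifs with h0
  · exact @MeasurableSet.empty ℝ (gF m)
  · have h2 : ∀ j, 1 ≤ j → j ≤ m → Measurable[gF m] (fun x => (pq j x : ℝ)) := fun j h1 h =>
      (measurable_from_top (f := fun z : ℕ => (z:ℝ))).comp (pq_gF h1 h)
    exact measurableSet_le measurable_const ((h2 n (by omega) (by omega)).mul (h2 (2*n) (by omega) (by omega)))

lemma gS_cond (k : ℕ) : ∀ᵐ x ∂gm,
    (1/2) * gX (k+1) x ≤ (gm[(gS (k+1)).indicator (1 : ℝ → ℝ) | gG k]) x := by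
  have hSm : MeasurableSet (gS (k+1)) := gF.le _ _ (gS_meas (k+1) _ le_rfl)
  have hSi : Integrable ((gS (k+1)).indicator (1 : ℝ → ℝ)) gm := (integrable_const (1:ℝ)).indicator hSm
  let c : ℕ → ℕ := fun j => max 1 ⌈gL (k+1) / j⌉₊
  let B : ℕ → Set ℝ := fun j => {x | c j ≤ pq (2*k+1+1) x}
  have hBi : ∀ j, Integrable ((B j).indicator (1 : ℝ → ℝ)) gm := fun j =>
    (integrable_const (1:ℝ)).indicator (measurableSet_le measurable_const (pq_meas _))
  let s : ℕ → Set ℝ := fun j => pq (k+1) ⁻¹' {j}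
  have hs : ∀ j, MeasurableSet[gF (2*k+1)] (s j) := fun j =>
    pq_gF (by omega) (by omega) (measurableSet_singleton j)
  have h0 : ∀ᵐ x ∂gm, 0 ≤ (gm[(gS (k+1)).indicator (1 : ℝ → ℝ) | gG k]) x :=
    condExp_nonneg (Eventually.of_forall fun x => Set.indicator_nonneg (fun _ _ => zero_le_one) _)
  have h1 : ∀ᵐ x ∂gm, ∀ j, 1/(c j : ℝ) ≤ (gm[(B j).indicator (1 : ℝ → ℝ) | gF (2*k+1)]) x := by
    rw [ae_all_iff]; exact fun j => cond_bound (2*k+1) (c j) (le_max_left _ _)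
  have h2 : ∀ᵐ x ∂gm, ∀ j, (gm[(s j).indicator ((B j).indicator (1 : ℝ → ℝ)) | gF (2*k+1)]) x =
      (s j).indicator (gm[(B j).indicator (1 : ℝ → ℝ) | gF (2*k+1)]) x := by
    rw [ae_all_iff]; exact fun j => condExp_indicator (hBi j) (hs j)
  have h3 : ∀ᵐ x ∂gm, ∀ j, (gm[(s j).indicator ((gS (k+1)).indicator (1 : ℝ → ℝ)) | gF (2*k+1)]) x =
      (s j).indicator (gm[(gS (k+1)).indicator (1 : ℝ → ℝ) | gF (2*k+1)]) x := by
    rw [ae_all_iff]; exact fun j => condExp_indicator hSi (hs j)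
  have h4 : ∀ᵐ x ∂gm, ∀ j, 1 ≤ j → (gm[(s j).indicator ((B j).indicator (1 : ℝ → ℝ)) | gF (2*k+1)]) x ≤
      (gm[(s j).indicator ((gS (k+1)).indicator (1 : ℝ → ℝ)) | gF (2*k+1)]) x := by
    rw [ae_all_iff]; intro j
    by_cases hj : 1 ≤ j
    swap
    · exact Eventually.of_forall fun x h => absurd h hj
    have := condExp_mono (m := gF (2*k+1)) ((hBi j).indicator (gF.le _ _ (hs j))) (hSi.indicator (gF.le _ _ (hs j)))
      (Eventually.of_forall (p := fun x => (s j).indicator ((B j).indicator (1 : ℝ → ℝ)) x ≤ (s j).indicator ((gS (k+1)).indicator (1 : ℝ → ℝ)) x) fun x => by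
        by_cases hx : x ∈ s j
        swap
        · simp [hx]
        rw [Set.indicator_of_mem hx, Set.indicator_of_mem hx]
        by_cases hxB : x ∈ B j
        swap
        · rw [Set.indicator_of_notMem hxB]; exact Set.indicator_nonneg (fun _ _ => zero_le_one) _
        have : x ∈ gS (k+1) := by
          have hx' : pq (k+1) x = j := hx
          have hxB' : c j ≤ pq (2*k+1+1) x := hxB
          have hj' : (0:ℝ) < j := by exact_mod_cast hj
          rw [gS, if_neg (by omega)]
          change gL (k+1) ≤ (pq (k+1) x : ℝ) * (pq (2*(k+1)) x : ℝ)
          rw [hx', mul_comm, ← div_le_iff₀ hj']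
          refine (Nat.le_ceil _).trans ?_
          exact_mod_cast (le_max_right _ _).trans hxB'
        rw [Set.indicator_of_mem this, Set.indicator_of_mem hxB])
    filter_upwards [this] with x hx _ using hx
  filter_upwards [h0, h1, h2, h3, h4] with x h0 h1 h2 h3 h4
  set j := pq (k+1) x with hj
  rcases Nat.eq_zero_or_pos j with hj0 | hj0
  · have : gX (k+1) x = 0 := by simp [gX, ← hj, hj0]
    rw [this, mul_zero]; exact h0
  have hxs : x ∈ s j := rfl
  have h2 := h2 j
  have h3 := h3 j
  have h4 := h4 j hj0
  rw [h2, h3, Set.indicator_of_mem hxs, Set.indicator_of_mem hxs] at h4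
  refine le_trans ?_ ((h1 j).trans h4)
  have hj' : (0:ℝ) < j := by exact_mod_cast hj0
  have hLn := gL_nonneg (k+1)
  have hc0 : (0:ℝ) < c j := by exact_mod_cast lt_of_lt_of_le one_pos (le_max_left 1 _)
  rw [gX, ← hj]
  rcases le_or_gt (gL (k+1)) j with hle | hlt
  · have : c j = 1 := by
      apply max_eq_left
      rw [Nat.ceil_le, Nat.cast_one, div_le_one hj']; exact hle
    rw [this]
    have := min_le_left (1:ℝ) (j / gL (k+1))
    norm_num; linarith
  · have hL0 : 0 < gL (k+1) := hj'.trans hlt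
    have hr : 1 < gL (k+1) / j := by rwa [one_lt_div hj']
    have hcle : (c j : ℝ) ≤ 2 * (gL (k+1) / j) := by
      have h5 := Nat.ceil_lt_add_one (R := ℝ) (a := gL (k+1) / j) (by positivity)
      simp only [c, Nat.cast_max]
      refine max_le (by push_cast; linarith) (by linarith)
    calc (1/2) * min 1 ((j:ℝ) / gL (k+1)) ≤ (1/2) * ((j:ℝ) / gL (k+1)) := by
          gcongr; exact min_le_right _ _
      _ = 1 / (2 * (gL (k+1) / j)) := by field_simp
      _ ≤ _ := by gcongr

lemma main_ae : ∀ᵐ x ∂gm, ∃ᶠ n : ℕ in atTop, x ∈ gS n := by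
  have h1 := ae_mem_limsup_atTop_iff (ℱ := gG) gm (s := gS) (fun n => gS_meas n (2*n+1) (by omega))
  have h2 : ∀ᵐ x ∂gm, ∀ k, (1/2) * gX (k+1) x ≤ (gm[(gS (k+1)).indicator (1 : ℝ → ℝ) | gG k]) x := by
    rw [ae_all_iff]; exact gS_cond
  filter_upwards [h1, h2, gX_div] with x h1 h2 h3
  rw [← mem_limsup_iff_frequently_mem, h1]
  exact tendsto_sum_of_le (fun n => gX_nonneg (n+1) x)
    (fun n => le_trans (by have := gX_nonneg (n+1) x; positivity) (h2 n)) h3 0 (1/2) (by norm_num) (fun n _ => h2 n)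

/-- For `d ≥ 2` and Lebesgue-almost every `x ∈ [0,1)`, the inequality
`a_n(x) a_{2n}(x) ⋯ a_{dn}(x) ≥ n (log n)^2` holds for infinitely many `n`. -/
theorem ae_frequently_prod_pq_large (d : ℕ) (hd : 2 ≤ d) :
    ∀ᵐ x ∂(volume : Measure ℝ), x ∈ Set.Ico (0 : ℝ) 1 →
      ∃ᶠ n : ℕ in Filter.atTop,
        (n : ℝ) * (Real.log n) ^ 2 ≤ ∏ i ∈ Finset.Icc 1 d, (pq (i * n) x : ℝ) := by
  have h : ∀ᵐ x ∂(volume : Measure ℝ), x ∈ gI → ∃ᶠ n : ℕ in atTop, x ∈ gS n :=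
    (ae_restrict_iff' gI_meas).1 main_ae
  have h0 : ∀ᵐ x : ℝ, x ≠ 0 := by simp [ae_iff]
  filter_upwards [h, gI_ae.mem_iff, h0] with x hx hI h0 hmem
  have hxI : x ∈ gI := hI.2 ⟨lt_of_le_of_ne hmem.1 h0.symm, hmem.2⟩
  refine (hx hxI).mono fun n hn => ?_
  unfold gS at hn
  split_ifs at hn with hn0
  · exact absurd hn (notMem_empty x)
  have hn : gL n ≤ (pq n x : ℝ) * (pq (2*n) x : ℝ) := hn
  have hone : ∀ m, (1:ℝ) ≤ (pq m x : ℝ) := fun m => by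
    exact_mod_cast floor_pos_gI (gaussIt_mem hxI (m-1))
  refine le_trans hn ?_
  have hsub : ({1, 2} : Finset ℕ) ⊆ Finset.Icc 1 d := by
    intro i hi
    simp only [Finset.mem_insert, Finset.mem_singleton] at hi
    rw [Finset.mem_Icc]; omega
  calc (pq n x : ℝ) * (pq (2*n) x : ℝ) = ∏ i ∈ ({1, 2} : Finset ℕ), (pq (i * n) x : ℝ) := by
        rw [Finset.prod_pair (by norm_num), one_mul]
    _ ≤ _ := Finset.prod_le_prod_of_subset_of_one_le hsub (fun i _ => by positivity) (fun i _ _ => hone _)
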